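/- arXiv:2310.00211 — 2 statements merged into one kernel-verified Lean document; each statement's English description precedes it below -/
import Mathlib

section
/- Let p ≥ 2, let B ⊆ ℝ^p be a non-empty open ball with 0 ∈ B, and let f : B → ℝ^p and g : B → ℝ^p form an isotonic unfolding pair on (B, B) with g(0) = 0. Then for all y ∈ B with −y ∈ B, one has g(−y) = −g(y). -/
open scoped InnerProductSpace

/-- The order condition of an isotonic unfolding pair on `(B, B)`. -/
def IsIsotonicOn {E : Type*} [NormedAddCommGroup E] (B : Set E) (f g : E → E) : Prop :=
  ∀ x ∈ B, ∀ y ∈ B, ∀ y' ∈ B, (‖x - y‖ < ‖x - y'‖ ↔ ‖f x - g y‖ < ‖f x - g y'‖)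

section

variable {E : Type*} [NormedAddCommGroup E] [InnerProductSpace ℝ E]

/-- A point equidistant from `a` and `b` lies on their perpendicular bisector. -/
theorem two_mul_inner_sub_of_norm_sub_eq {c a b : E} (h : ‖c - a‖ = ‖c - b‖) :
    2 * ⟪c, a - b⟫_ℝ = ‖a‖ ^ 2 - ‖b‖ ^ 2 := by
  have h2 : ‖c - a‖ ^ 2 = ‖c - b‖ ^ 2 := by rw [h]
  rw [norm_sub_sq_real, norm_sub_sq_real] at h2
  rw [inner_sub_right]
  linarith

/-- Reflected points are equidistant from every point of the mirror. -/
theorem norm_sub_eq_of_mem_mirror {x z z' e : E} {τ : ℝ} (h : z - z' = τ • e)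
    (hx : ⟪z + z' - (2 : ℝ) • x, e⟫_ℝ = 0) : ‖x - z‖ = ‖x - z'‖ := by
  have hz : z = z' + τ • e := by rw [← h]; abel
  have h1 : ⟪x - z', e⟫_ℝ * 2 = τ * ⟪e, e⟫_ℝ := by
    subst hz
    simp only [inner_sub_left, inner_add_left, inner_smul_left, RCLike.conj_to_real] at hx ⊢
    linarith
  have h2 : x - z = (x - z') - τ • e := by rw [hz]; abel
  have h3 : ‖x - z‖ ^ 2 = ‖x - z'‖ ^ 2 := by
    rw [h2, norm_sub_sq_real, inner_smul_right, norm_smul, mul_pow, Real.norm_eq_abs, sq_abs,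
      ← real_inner_self_eq_norm_sq e]
    linear_combination (-τ) * h1
  exact (sq_eq_sq₀ (norm_nonneg _) (norm_nonneg _)).1 h3

/-- If `v` and `n` are biorthogonal families of full size, a vector orthogonal to all `v j` with
`j ≠ i` is a multiple of `n i`. -/
theorem exists_eq_smul_of_biorthogonal {ι : Type*} [Fintype ι] [FiniteDimensional ℝ E]
    (hcard : Fintype.card ι = Module.finrank ℝ E) {v n : ι → E}
    (hvn : ∀ i j, i ≠ j → ⟪v i, n j⟫_ℝ = 0) (hv : ∀ i, ⟪v i, n i⟫_ℝ ≠ 0) (i : ι) {w : E}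
    (hw : ∀ j, j ≠ i → ⟪v j, w⟫_ℝ = 0) : ∃ c : ℝ, w = c • n i := by
  classical
  have hli : LinearIndependent ℝ v := by
    rw [Fintype.linearIndependent_iff]
    intro a ha j
    have h1 : ⟪∑ k, a k • v k, n j⟫_ℝ = 0 := by rw [ha, inner_zero_left]
    rw [sum_inner, Finset.sum_eq_single j] at h1
    · rw [inner_smul_left] at h1
      exact (mul_eq_zero.1 h1).resolve_right (hv j)
    · intro k _ hk
      rw [inner_smul_left, hvn k j hk, mul_zero]
    · simp
  have hspan := hli.span_eq_top_of_card_eq_finrank' hcard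
  refine ⟨⟪v i, w⟫_ℝ / ⟪v i, n i⟫_ℝ, ?_⟩
  rw [← sub_eq_zero]
  set u := w - (⟪v i, w⟫_ℝ / ⟪v i, n i⟫_ℝ) • n i with hu
  have horth : ∀ j, ⟪v j, u⟫_ℝ = 0 := by
    intro j
    rw [hu, inner_sub_right, inner_smul_right]
    by_cases hj : j = i
    · subst hj
      rw [div_mul_cancel₀ _ (hv j), sub_self]
    · rw [hw j hj, hvn j i hj, mul_zero, sub_zero]
  have hall : ∀ x ∈ Submodule.span ℝ (Set.range v), ⟪x, u⟫_ℝ = 0 := by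
    intro x hx
    induction hx using Submodule.span_induction with
    | mem x hx => obtain ⟨j, rfl⟩ := hx; exact horth j
    | zero => exact inner_zero_left _
    | add x y _ _ hx hy => rw [inner_add_left, hx, hy, add_zero]
    | smul a x _ hx => rw [inner_smul_left, hx, mul_zero]
  exact inner_self_eq_zero.1 (hall u (hspan ▸ Submodule.mem_top))

end

namespace IsIsotonicOn

theorem norm_sub_eq {E : Type*} [NormedAddCommGroup E] {B : Set E} {f g : E → E}
    (h : IsIsotonicOn B f g) {x z z' : E} (hx : x ∈ B) (hz : z ∈ B) (hz' : z' ∈ B)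
    (he : ‖x - z‖ = ‖x - z'‖) : ‖f x - g z‖ = ‖f x - g z'‖ := by
  apply le_antisymm
  · exact not_lt.1 fun hlt => ((h x hx z' hz' z hz).2 hlt).ne he.symm
  · exact not_lt.1 fun hlt => ((h x hx z hz z' hz').2 hlt).ne he

section

variable {E : Type*} [NormedAddCommGroup E] [InnerProductSpace ℝ E] {B : Set E} {f g : E → E}

/-- In terms of an orthonormal basis `b` and a point `q` of an open set, images under `g` of pairs
of points reflected in the hyperplane through `q` orthogonal to `b i` differ by a multiple of a
vector `N i`, and these vectors are orthogonal. -/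
theorem exists_orthogonal_normals {ι : Type*} [Fintype ι] (h : IsIsotonicOn B f g)
    (hB : IsOpen B) (hg : Set.InjOn g B) (b : OrthonormalBasis ι ℝ E) {q : E} (hq : q ∈ B) :
    ∃ N : ι → E, (∀ i, N i ≠ 0) ∧ (∀ i j, i ≠ j → ⟪N i, N j⟫_ℝ = 0) ∧
      ∀ i, ∀ z ∈ B, ∀ z' ∈ B, ∀ τ : ℝ, z - z' = τ • b i →
        ⟪z + z' - (2 : ℝ) • q, b i⟫_ℝ = 0 → ∃ c : ℝ, g z - g z' = c • N i := by
  have hfin : FiniteDimensional ℝ E := b.toBasis.finiteDimensional_of_finite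
  have hcard : Fintype.card ι = Module.finrank ℝ E := (Module.finrank_eq_card_basis b.toBasis).symm
  obtain ⟨r, hr, hrB⟩ := Metric.isOpen_iff.1 hB q hq
  obtain ⟨δ, hδ, hδr⟩ : ∃ δ : ℝ, 0 < δ ∧ 2 * δ < r := ⟨r / 3, by linarith, by linarith⟩
  have hb1 : ∀ i, ‖b i‖ = 1 := b.orthonormal.1
  have hb0 : ∀ i j, i ≠ j → ⟪b i, b j⟫_ℝ = 0 := fun i j hij => b.orthonormal.2 hij
  have hbb : ∀ i, ⟪b i, b i⟫_ℝ = 1 := fun i => by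
    rw [real_inner_self_eq_norm_sq, hb1, one_pow]
  have hmem : ∀ (s t : ℝ) (i j : ι), |s| ≤ δ → |t| ≤ δ → q + (s • b i + t • b j) ∈ B := by
    intro s t i j hs ht
    apply hrB
    rw [mem_ball_iff_norm, add_sub_cancel_left]
    calc ‖s • b i + t • b j‖ ≤ ‖s • b i‖ + ‖t • b j‖ := norm_add_le _ _
      _ = |s| + |t| := by simp [norm_smul, hb1]
      _ < r := by linarith
  have hδa : |δ| ≤ δ := (abs_of_pos hδ).le
  have hδn : |-δ| ≤ δ := by rw [abs_neg]; exact hδa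
  have hmem1 : ∀ (s : ℝ) (i : ι), |s| ≤ δ → q + s • b i ∈ B := by
    intro s i hs
    simpa using hmem s 0 i i hs (by simpa using hδ.le)
  have bisect : ∀ i, ∀ z ∈ B, ∀ z' ∈ B, ∀ τ : ℝ, z - z' = τ • b i →
      ⟪z + z' - (2 : ℝ) • q, b i⟫_ℝ = 0 → ∀ x ∈ B, ⟪x - q, b i⟫_ℝ = 0 →
      2 * ⟪f x, g z - g z'⟫_ℝ = ‖g z‖ ^ 2 - ‖g z'‖ ^ 2 := by
    intro i z hz z' hz' τ hzz hzq x hx hxq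
    refine two_mul_inner_sub_of_norm_sub_eq (h.norm_sub_eq hx hz hz' ?_)
    refine norm_sub_eq_of_mem_mirror hzz ?_
    have : z + z' - (2 : ℝ) • x = (z + z' - (2 : ℝ) • q) - (2 : ℝ) • (x - q) := by module
    rw [this, inner_sub_left, inner_smul_left, hzq, hxq]
    simp
  have hqq : ∀ i, ⟪q - q, b i⟫_ℝ = 0 := fun i => by simp
  let v : ι → E := fun i => f (q + δ • b i) - f q
  let N : ι → E := fun i => g (q + δ • b i) - g (q + (-δ) • b i)
  have orth : ∀ i, ∀ z ∈ B, ∀ z' ∈ B, ∀ τ : ℝ, z - z' = τ • b i →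
      ⟪z + z' - (2 : ℝ) • q, b i⟫_ℝ = 0 → ∀ j, j ≠ i → ⟪v j, g z - g z'⟫_ℝ = 0 := by
    intro i z hz z' hz' τ hzz hzq j hj
    have h1 := bisect i z hz z' hz' τ hzz hzq q hq (hqq i)
    have h2 := bisect i z hz z' hz' τ hzz hzq _ (hmem1 δ j hδa)
      (by rw [add_sub_cancel_left, inner_smul_left, hb0 j i hj, mul_zero])
    simp only [v]
    rw [inner_sub_left]
    linarith
  have hNz : ∀ i, (q + δ • b i) - (q + (-δ) • b i) = (2 * δ) • b i := fun i => by module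
  have hNq : ∀ i, ⟪(q + δ • b i) + (q + (-δ) • b i) - (2 : ℝ) • q, b i⟫_ℝ = 0 := fun i => by
    have : (q + δ • b i) + (q + (-δ) • b i) - (2 : ℝ) • q = 0 := by module
    rw [this, inner_zero_left]
  have hvn : ∀ i j, i ≠ j → ⟪v i, N j⟫_ℝ = 0 := fun i j hij =>
    orth j _ (hmem1 δ j hδa) _ (hmem1 (-δ) j hδn) _ (hNz j) (hNq j) i hij
  have hv : ∀ i, ⟪v i, N i⟫_ℝ ≠ 0 := by
    intro i h0
    have h1 := bisect i _ (hmem1 δ i hδa) _ (hmem1 (-δ) i hδn) _ (hNz i) (hNq i) q hq (hqq i)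
    have hlt : ‖(q + δ • b i) - (q + δ • b i)‖ < ‖(q + δ • b i) - (q + (-δ) • b i)‖ := by
      rw [hNz, sub_self, norm_zero, norm_smul, hb1, mul_one, Real.norm_eq_abs]
      positivity
    have h2 := (h _ (hmem1 δ i hδa) _ (hmem1 δ i hδa) _ (hmem1 (-δ) i hδn)).1 hlt
    have h3 := pow_lt_pow_left₀ h2 (norm_nonneg _) two_ne_zero
    rw [norm_sub_sq_real, norm_sub_sq_real] at h3
    simp only [v, N] at h0
    rw [inner_sub_left, sub_eq_zero] at h0
    rw [← h0, inner_sub_right] at h1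
    linarith
  have par : ∀ i, ∀ z ∈ B, ∀ z' ∈ B, ∀ τ : ℝ, z - z' = τ • b i →
        ⟪z + z' - (2 : ℝ) • q, b i⟫_ℝ = 0 → ∃ c : ℝ, g z - g z' = c • N i :=
    fun i z hz z' hz' τ hzz hzq =>
      exists_eq_smul_of_biorthogonal hcard hvn hv i (orth i z hz z' hz' τ hzz hzq)
  refine ⟨N, fun i hi => hv i (by rw [hi, inner_zero_right]), ?_, par⟩
  intro i j hij
  have hne : ∀ z ∈ B, ∀ z' ∈ B, ∀ (k : ι) (c : ℝ), z - z' = (2 * δ) • b k →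
      g z - g z' = c • N k → c ≠ 0 := by
    rintro z hz z' hz' k c hzz hc rfl
    rw [zero_smul, sub_eq_zero] at hc
    rw [hg hz hz' hc, sub_self, eq_comm, smul_eq_zero] at hzz
    rcases hzz with h0 | h0
    · linarith
    · simpa [h0] using hb1 k
  have hPP := hmem δ δ i j hδa hδa
  have hMP := hmem (-δ) δ i j hδn hδa
  have hPM := hmem δ (-δ) i j hδa hδn
  have hMM := hmem (-δ) (-δ) i j hδn hδn
  have hi : ∀ t : ℝ, (q + (δ • b i + t • b j)) - (q + ((-δ) • b i + t • b j)) = (2 * δ) • b i :=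
    fun t => by module
  have hj : ∀ s : ℝ, (q + (s • b i + δ • b j)) - (q + (s • b i + (-δ) • b j)) = (2 * δ) • b j :=
    fun s => by module
  have hiq : ∀ t : ℝ, ⟪(q + (δ • b i + t • b j)) + (q + ((-δ) • b i + t • b j)) - (2 : ℝ) • q,
      b i⟫_ℝ = 0 := fun t => by
    have : (q + (δ • b i + t • b j)) + (q + ((-δ) • b i + t • b j)) - (2 : ℝ) • q
        = (2 * t) • b j := by module
    rw [this, inner_smul_left, hb0 j i hij.symm, mul_zero]
  have hjq : ∀ s : ℝ, ⟪(q + (s • b i + δ • b j)) + (q + (s • b i + (-δ) • b j)) - (2 : ℝ) • q,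
      b j⟫_ℝ = 0 := fun s => by
    have : (q + (s • b i + δ • b j)) + (q + (s • b i + (-δ) • b j)) - (2 : ℝ) • q
        = (2 * s) • b i := by module
    rw [this, inner_smul_left, hb0 i j hij, mul_zero]
  obtain ⟨c₁, hc₁⟩ := par i _ hPP _ hMP _ (hi δ) (hiq δ)
  obtain ⟨c₂, hc₂⟩ := par i _ hPM _ hMM _ (hi (-δ)) (hiq (-δ))
  obtain ⟨d₁, hd₁⟩ := par j _ hPP _ hPM _ (hj δ) (hjq δ)
  obtain ⟨d₂, hd₂⟩ := par j _ hMP _ hMM _ (hj (-δ)) (hjq (-δ))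
  have e₁ := bisect i _ hPP _ hMP _ (hi δ) (hiq δ) q hq (hqq i)
  have e₂ := bisect i _ hPM _ hMM _ (hi (-δ)) (hiq (-δ)) q hq (hqq i)
  have hc₁0 := hne _ hPP _ hMP i c₁ (hi δ) hc₁
  have hd₂0 := hne _ hMP _ hMM j d₂ (hj (-δ)) hd₂
  generalize g (q + (δ • b i + δ • b j)) = a₁ at *
  generalize g (q + ((-δ) • b i + δ • b j)) = a₂ at *
  generalize g (q + (δ • b i + (-δ) • b j)) = a₃ at *
  generalize g (q + ((-δ) • b i + (-δ) • b j)) = a₄ at *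
  have hcc : c₁ = c₂ := by
    have h1 : (c₁ - c₂) • N i = (d₁ - d₂) • N j := by
      rw [sub_smul, sub_smul, ← hc₁, ← hc₂, ← hd₁, ← hd₂]; abel
    have h2 : ⟪v i, (c₁ - c₂) • N i⟫_ℝ = 0 := by
      rw [h1, inner_smul_right, hvn i j hij, mul_zero]
    rw [inner_smul_right] at h2
    exact sub_eq_zero.1 ((mul_eq_zero.1 h2).resolve_right (hv i))
  subst hcc
  rw [hc₁] at e₁
  rw [hc₂, e₁] at e₂
  have ha₁ : a₁ = a₂ + c₁ • N i := by rw [← hc₁]; abel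
  have ha₃ : a₃ = a₄ + c₁ • N i := by rw [← hc₂]; abel
  rw [ha₁, ha₃, norm_add_sq_real, norm_add_sq_real] at e₂
  have h3 : ⟪a₂ - a₄, c₁ • N i⟫_ℝ = 0 := by rw [inner_sub_left]; linarith
  rw [hd₂, inner_smul_left, inner_smul_right, real_inner_comm] at h3
  simpa [hc₁0, hd₂0] using h3

/-- Differences of `g` along a line through `0` lie on a line. -/
theorem exists_common_direction {ι : Type*} [Fintype ι] (h : IsIsotonicOn B f g)
    (hB : IsOpen B) (hconv : Convex ℝ B) (h0 : (0 : E) ∈ B) (hg : Set.InjOn g B)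
    (b : OrthonormalBasis ι ℝ E) (i : ι) :
    ∃ n : E, n ≠ 0 ∧ ∀ s t : ℝ, s • b i ∈ B → t • b i ∈ B →
      ∃ c : ℝ, g (s • b i) - g (t • b i) = c • n := by
  have hfin : FiniteDimensional ℝ E := b.toBasis.finiteDimensional_of_finite
  have hcard : Fintype.card ι = Module.finrank ℝ E := (Module.finrank_eq_card_basis b.toBasis).symm
  obtain ⟨N, hN0, hNN, hN⟩ := h.exists_orthogonal_normals hB hg b h0
  refine ⟨N i, hN0 i, fun s t hs ht => ?_⟩
  have hq : ((s + t) / 2) • b i ∈ B := by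
    have := hconv hs ht (a := 1 / 2) (b := 1 / 2) (by norm_num) (by norm_num) (by norm_num)
    convert this using 1
    module
  obtain ⟨M, hM0, hMM, hM⟩ := h.exists_orthogonal_normals hB hg b hq
  set q := ((s + t) / 2) • b i with hqdef
  obtain ⟨c, hc⟩ := hM i _ hs _ ht (s - t) (by module) (by
    have : s • b i + t • b i - (2 : ℝ) • q = 0 := by rw [hqdef]; module
    rw [this, inner_zero_left])
  refine exists_eq_smul_of_biorthogonal hcard hNN (fun k => inner_self_ne_zero.2 (hN0 k)) i
    fun j hj => ?_
  obtain ⟨r, hr, hrB⟩ := Metric.isOpen_iff.1 hB q hq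
  have hmem : ∀ τ : ℝ, |τ| < r → q + τ • b j ∈ B := fun τ hτ => hrB (by
    rw [mem_ball_iff_norm, add_sub_cancel_left, norm_smul, b.orthonormal.1 j, mul_one]
    exact hτ)
  have hP := hmem (r / 2) (by rw [abs_of_pos] <;> linarith)
  have hM' := hmem (-(r / 2)) (by rw [abs_neg, abs_of_pos] <;> linarith)
  have hdiff : (q + (r / 2) • b j) - (q + (-(r / 2)) • b j) = r • b j := by module
  obtain ⟨c₁, hc₁⟩ := hN j _ hP _ hM' r hdiff (by
    have : (q + (r / 2) • b j) + (q + (-(r / 2)) • b j) - (2 : ℝ) • (0 : E) = (s + t) • b i := by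
      rw [hqdef]; module
    rw [this, inner_smul_left, b.orthonormal.2 hj.symm, mul_zero])
  obtain ⟨c₂, hc₂⟩ := hM j _ hP _ hM' r hdiff (by
    have : (q + (r / 2) • b j) + (q + (-(r / 2)) • b j) - (2 : ℝ) • q = 0 := by module
    rw [this, inner_zero_left])
  have hc₁0 : c₁ ≠ 0 := by
    rintro rfl
    rw [zero_smul, sub_eq_zero] at hc₁
    rw [hg hP hM' hc₁, sub_self, eq_comm, smul_eq_zero] at hdiff
    exact hdiff.elim hr.ne' (b.orthonormal.ne_zero j)
  have h1 : ⟪c₁ • N j, g (s • b i) - g (t • b i)⟫_ℝ = 0 := by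
    rw [← hc₁, hc₂, hc, inner_smul_left, inner_smul_right, hMM j i hj, mul_zero, mul_zero]
  rw [inner_smul_left] at h1
  exact (mul_eq_zero.1 h1).resolve_left (by simpa using hc₁0)

/-- If `g 0 = 0` then `g` is odd along every coordinate axis of an orthonormal basis. -/
theorem map_neg_of_axis {ι : Type*} [Fintype ι] (h : IsIsotonicOn B f g)
    (hB : IsOpen B) (hconv : Convex ℝ B) (h0 : (0 : E) ∈ B) (hg : Set.InjOn g B) (hg0 : g 0 = 0)
    (b : OrthonormalBasis ι ℝ E) (i : ι) {r : ℝ} (hr : 0 < r) (hP : r • b i ∈ B)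
    (hM : -(r • b i) ∈ B) : g (-(r • b i)) = -g (r • b i) := by
  obtain ⟨n, hn, hline⟩ := h.exists_common_direction hB hconv h0 hg b i
  have hmem : ∀ s : ℝ, |s| ≤ 1 → (s * r) • b i ∈ B := by
    intro s hs
    have hs' := abs_le.1 hs
    have := hconv hP hM (a := (1 + s) / 2) (b := (1 - s) / 2) (by linarith) (by linarith) (by ring)
    convert this using 1
    module
  have hG : ∀ s : ℝ, ∃ c : ℝ, |s| ≤ 1 → g ((s * r) • b i) = c • n := by
    intro s
    by_cases hs : |s| ≤ 1
    · obtain ⟨c, hc⟩ := hline (s * r) 0 (hmem s hs) (by simpa using h0)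
      rw [zero_smul, hg0, sub_zero] at hc
      exact ⟨c, fun _ => hc⟩
    · exact ⟨0, fun hs' => absurd hs' hs⟩
  choose G hG using hG
  let F : ℝ → ℝ := fun s => ⟪f ((s * r) • b i), n⟫_ℝ
  have key : ∀ s t m : ℝ, |s| ≤ 1 → |t| ≤ 1 → s ≠ t → s + t = 2 * m →
      2 * F m = ‖n‖ ^ 2 * (G s + G t) := by
    intro s t m hs ht hst hm
    have hm1 : |m| ≤ 1 := by
      rw [abs_le] at *
      constructor <;> linarith
    have heq : ‖(m * r) • b i - (s * r) • b i‖ = ‖(m * r) • b i - (t * r) • b i‖ := by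
      have hms : m = (s + t) / 2 := by linarith
      have : (m * r) • b i - (s * r) • b i = -((m * r) • b i - (t * r) • b i) := by
        rw [hms]; module
      rw [this, norm_neg]
    have h1 := two_mul_inner_sub_of_norm_sub_eq
      (h.norm_sub_eq (hmem m hm1) (hmem s hs) (hmem t ht) heq)
    rw [hG s hs, hG t ht, ← sub_smul, inner_smul_right, norm_smul, norm_smul, mul_pow, mul_pow,
      Real.norm_eq_abs, Real.norm_eq_abs, sq_abs, sq_abs] at h1
    have hne : G s - G t ≠ 0 := by
      intro h2
      apply hst
      have h3 : g ((s * r) • b i) = g ((t * r) • b i) := by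
        rw [hG s hs, hG t ht, sub_eq_zero.1 h2]
      have h4 := smul_left_injective ℝ (b.orthonormal.ne_zero i) (hg (hmem s hs) (hmem t ht) h3)
      exact mul_right_cancel₀ hr.ne' h4
    apply mul_right_cancel₀ hne
    simp only [F]
    linear_combination h1
  have hG0 : G 0 = 0 := by
    have := hG 0 (by simp)
    rw [zero_mul, zero_smul, hg0, eq_comm, smul_eq_zero] at this
    exact this.resolve_right hn
  have k₁ := key 1 0 (1 / 2) (by simp) (by simp) (by norm_num) (by norm_num)
  have k₂ := key (-1) 0 (-1 / 2) (by simp) (by simp) (by norm_num) (by norm_num)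
  have k₃ := key 1 (-1) 0 (by simp) (by simp) (by norm_num) (by norm_num)
  have k₄ := key (3 / 4) (1 / 4) (1 / 2) (by norm_num [abs_le]) (by norm_num [abs_le])
    (by norm_num) (by norm_num)
  have k₅ := key (-3 / 4) (-1 / 4) (-1 / 2) (by norm_num [abs_le]) (by norm_num [abs_le])
    (by norm_num) (by norm_num)
  have k₆ := key (3 / 4) (-3 / 4) 0 (by norm_num [abs_le]) (by norm_num [abs_le])
    (by norm_num) (by norm_num)
  have k₇ := key (1 / 4) (-1 / 4) 0 (by norm_num [abs_le]) (by norm_num [abs_le])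
    (by norm_num) (by norm_num)
  have hsum : ‖n‖ ^ 2 * (G 1 + G (-1)) = 0 := by
    rw [hG0] at k₁ k₂
    linarith
  have hodd : G (-1) = -G 1 := by
    have := (mul_eq_zero.1 hsum).resolve_left (by simpa using hn)
    linarith
  have e₁ := hG 1 (by simp)
  have e₂ := hG (-1) (by simp)
  rw [one_mul] at e₁
  rw [neg_one_mul, neg_smul] at e₂
  rw [e₁, e₂, hodd, neg_smul]

end

end IsIsotonicOn

/-- **Lemma: `g` is odd.** Let `p ≥ 2`, let `B ⊆ ℝ^p` be a
non-empty open ball containing `0`, and let `(f, g)` be an isotonic unfolding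
pair on `(B, B)` with `g 0 = 0`. Then `g (-y) = -g y` for all `y ∈ B` with
`-y ∈ B`. -/
theorem internal_unfolding_odd
    (p : ℕ) (hp : 2 ≤ p) (B : Set (EuclideanSpace ℝ (Fin p)))
    (hB : ∃ (z : EuclideanSpace ℝ (Fin p)) (r : ℝ), 0 < r ∧ B = Metric.ball z r)
    (h0 : (0 : EuclideanSpace ℝ (Fin p)) ∈ B)
    (f g : EuclideanSpace ℝ (Fin p) → EuclideanSpace ℝ (Fin p))
    (hf_inj : Set.InjOn f B) (hg_inj : Set.InjOn g B)
    (hpair : ∀ x ∈ B, ∀ y ∈ B, ∀ y' ∈ B,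
      (‖x - y‖ < ‖x - y'‖ ↔ ‖f x - g y‖ < ‖f x - g y'‖))
    (hg0 : g 0 = 0)
    (y : EuclideanSpace ℝ (Fin p)) (hy : y ∈ B) (hny : -y ∈ B) :
    g (-y) = -g y := by
  obtain ⟨z, r, hr, rfl⟩ := hB
  by_cases hy0 : y = 0
  · simp [hy0, hg0]
  have hypos : 0 < ‖y‖ := norm_pos_iff.2 hy0
  let i : Fin p := ⟨0, by omega⟩
  obtain ⟨b, hb⟩ := Orthonormal.exists_orthonormalBasis_extension_of_card_eq
    (𝕜 := ℝ) (E := EuclideanSpace ℝ (Fin p)) (ι := Fin p) (by simp)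
    (v := fun _ => ‖y‖⁻¹ • y) (s := {i}) (by
      constructor
      · intro j
        simp [norm_smul, hypos.ne']
      · intro j k hjk
        exact absurd (Subsingleton.elim j k) hjk)
  have hyb : ‖y‖ • b i = y := by
    rw [hb i rfl, smul_smul, mul_inv_cancel₀ hypos.ne', one_smul]
  have := IsIsotonicOn.map_neg_of_axis (f := f) hpair Metric.isOpen_ball (convex_ball z r) h0 hg_inj
    hg0 b i hypos (by rwa [hyb]) (by rwa [hyb])
  rwa [hyb] at this
end

section
/- Let p ≥ 2, let B ⊆ ℝ^p be a non-empty open ball with 0 ∈ B, and let f : B → ℝ^p and g : B → ℝ^p form an isotonic unfolding pair on (B, B) with g(0) = 0. Then f(0) = 0. -/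
open scoped RealInnerProductSpace

section Bisector

variable {E : Type*} [NormedAddCommGroup E] [InnerProductSpace ℝ E]

/-- Difference of squared distances from `x` to `a` and `b`, as an inner product. -/
lemma norm_sub_sq_sub_norm_sub_sq (x a b : E) :
    ‖x - a‖ ^ 2 - ‖x - b‖ ^ 2 = ⟪a - b, a + b - (2 : ℝ) • x⟫ := by
  rw [norm_sub_sq_real, norm_sub_sq_real]
  simp only [inner_sub_left, inner_sub_right, inner_add_right, inner_smul_right,
    real_inner_self_eq_norm_sq]
  rw [real_inner_comm a x, real_inner_comm b x, real_inner_comm b a]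
  ring

lemma norm_sub_eq_norm_sub_iff (x a b : E) :
    ‖x - a‖ = ‖x - b‖ ↔ ⟪a - b, a + b - (2 : ℝ) • x⟫ = 0 := by
  rw [← norm_sub_sq_sub_norm_sub_sq, sub_eq_zero, sq_eq_sq₀ (norm_nonneg _) (norm_nonneg _)]

lemma norm_sub_lt_norm_sub_iff (x a b : E) :
    ‖x - a‖ < ‖x - b‖ ↔ ⟪a - b, a + b - (2 : ℝ) • x⟫ < 0 := by
  rw [← norm_sub_sq_sub_norm_sub_sq, sub_neg, sq_lt_sq₀ (norm_nonneg _) (norm_nonneg _)]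

end Bisector

section Biorthogonal

variable {E ι : Type*} [NormedAddCommGroup E] [InnerProductSpace ℝ E] [FiniteDimensional ℝ E]
  [Fintype ι]

/-- A vector orthogonal to every member of a biorthogonal family of full size vanishes. -/
lemma eq_zero_of_biorthogonal (hcard : Fintype.card ι = Module.finrank ℝ E) {m n : ι → E}
    (hne : ∀ j k, j ≠ k → ⟪m j, n k⟫ = 0) (hself : ∀ j, ⟪m j, n j⟫ ≠ 0)
    {v : E} (hv : ∀ j, ⟪m j, v⟫ = 0) : v = 0 := by
  have hli : LinearIndependent ℝ m := by
    rw [Fintype.linearIndependent_iff]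
    intro a ha k
    have h : ⟪∑ i, a i • m i, n k⟫ = 0 := by rw [ha, inner_zero_left]
    rw [sum_inner, Finset.sum_eq_single k] at h
    · rw [real_inner_smul_left] at h
      exact (mul_eq_zero.mp h).resolve_right (hself k)
    · intro j _ hj
      rw [real_inner_smul_left, hne j k hj, mul_zero]
    · simp
  have hspan : v ∈ Submodule.span ℝ (Set.range m) := by
    rw [hli.span_eq_top_of_card_eq_finrank' hcard]
    trivial
  have hall : ∀ w ∈ Submodule.span ℝ (Set.range m), ⟪w, v⟫ = 0 := by
    intro w hw
    induction hw using Submodule.span_induction with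
    | mem x hx =>
      obtain ⟨j, rfl⟩ := hx
      exact hv j
    | zero => exact inner_zero_left _
    | add x y _ _ hx hy => rw [inner_add_left, hx, hy, add_zero]
    | smul a x _ hx => rw [real_inner_smul_left, hx, mul_zero]
  exact inner_self_eq_zero.mp (hall v hspan)

/-- For a biorthogonal family of full size, a vector orthogonal to all `m j` with `j ≠ i` is a
multiple of `n i`. -/
lemma exists_eq_smul_of_biorthogonal_s14 (hcard : Fintype.card ι = Module.finrank ℝ E) {m n : ι → E}
    (hne : ∀ j k, j ≠ k → ⟪m j, n k⟫ = 0) (hself : ∀ j, ⟪m j, n j⟫ ≠ 0)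
    (i : ι) {v : E} (hv : ∀ j, j ≠ i → ⟪m j, v⟫ = 0) : ∃ a : ℝ, v = a • n i := by
  refine ⟨⟪m i, v⟫ / ⟪m i, n i⟫, sub_eq_zero.mp ?_⟩
  refine eq_zero_of_biorthogonal hcard hne hself fun j => ?_
  rw [inner_sub_right, real_inner_smul_right]
  by_cases hj : j = i
  · subst hj
    rw [div_mul_cancel₀ _ (hself j), sub_self]
  · rw [hv j hj, hne j i hj, mul_zero, sub_zero]

end Biorthogonal

/-- The symmetric difference of `f` at `c` in direction `v`. -/
def centralDiff {E : Type*} [AddCommGroup E] (f : E → E) (c v : E) : E :=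
  f (c + v) - f (c - v)

/-- An isotonic pair `(f, g)` on a set containing a large enough ball around the origin, together
with an orthogonal basis `u` of vectors of norm `s`. -/
structure IsotonicFrame {E ι : Type*} [NormedAddCommGroup E] [InnerProductSpace ℝ E]
    [Fintype ι] (B : Set E) (f g : E → E) (u : ι → E) (s : ℝ) : Prop where
  pair : ∀ x ∈ B, ∀ y ∈ B, ∀ y' ∈ B, (‖x - y‖ < ‖x - y'‖ ↔ ‖f x - g y‖ < ‖f x - g y'‖)
  inj : Set.InjOn g B
  pos : 0 < s
  norm_eq : ∀ i, ‖u i‖ = s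
  ortho : ∀ i j, i ≠ j → ⟪u i, u j⟫ = 0
  card_eq : Fintype.card ι = Module.finrank ℝ E
  mem : ∀ v, ‖v‖ ≤ 8 * s → v ∈ B

namespace IsotonicFrame

variable {E ι : Type*} [NormedAddCommGroup E] [InnerProductSpace ℝ E] [Fintype ι]
  {B : Set E} {f g : E → E} {u : ι → E} {s : ℝ}

lemma add_mem (F : IsotonicFrame B f g u s) {c v : E} (hc : ‖c‖ ≤ 6 * s) (hv : ‖v‖ ≤ 2 * s) :
    c + v ∈ B :=
  F.mem _ ((norm_add_le c v).trans (by linarith))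

lemma add_basis_mem (F : IsotonicFrame B f g u s) {c : E} (hc : ‖c‖ ≤ 6 * s) (i : ι) :
    c + u i ∈ B :=
  F.add_mem hc (by rw [F.norm_eq]; linarith [F.pos])

lemma sub_basis_mem (F : IsotonicFrame B f g u s) {c : E} (hc : ‖c‖ ≤ 6 * s) (i : ι) :
    c - u i ∈ B := by
  rw [sub_eq_add_neg]
  exact F.add_mem hc (by rw [norm_neg, F.norm_eq]; linarith [F.pos])

lemma basis_ne_zero (F : IsotonicFrame B f g u s) (i : ι) : u i ≠ 0 := by
  rw [← norm_pos_iff, F.norm_eq]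
  exact F.pos

lemma smul_mem (F : IsotonicFrame B f g u s) (i : ι) {t : ℝ} (ht : |t| ≤ 3) : t • u i ∈ B := by
  refine F.mem _ ?_
  rw [norm_smul, F.norm_eq, Real.norm_eq_abs]
  nlinarith [F.pos]

/-- Points on a bisector are mapped to points on the bisector of the images. -/
lemma inner_eq_zero (F : IsotonicFrame B f g u s) {x y y' : E} (hx : x ∈ B) (hy : y ∈ B)
    (hy' : y' ∈ B) (h : ⟪y - y', y + y' - (2 : ℝ) • x⟫ = 0) :
    ⟪g y - g y', g y + g y' - (2 : ℝ) • f x⟫ = 0 := by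
  rw [← norm_sub_eq_norm_sub_iff] at h ⊢
  exact le_antisymm
    (not_lt.mp fun hlt => h.symm.not_lt ((F.pair x hx y' hy' y hy).mpr hlt))
    (not_lt.mp fun hlt => h.not_lt ((F.pair x hx y hy y' hy').mpr hlt))

lemma inner_neg (F : IsotonicFrame B f g u s) {y y' : E} (hy : y ∈ B) (hy' : y' ∈ B)
    (hne : y ≠ y') : ⟪g y - g y', g y + g y' - (2 : ℝ) • f y⟫ < 0 := by
  rw [← norm_sub_lt_norm_sub_iff]
  refine (F.pair y hy y hy y' hy').mp ?_
  rw [sub_self, norm_zero]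
  exact norm_pos_iff.mpr (sub_ne_zero.mpr hne)

/-- Differences of `f` along a bisector are orthogonal to the difference of `g`. -/
lemma inner_sub_eq_zero (F : IsotonicFrame B f g u s) {x x' y y' : E} (hx : x ∈ B) (hx' : x' ∈ B)
    (hy : y ∈ B) (hy' : y' ∈ B) (h : ⟪y - y', y + y' - (2 : ℝ) • x⟫ = 0)
    (h' : ⟪y - y', y + y' - (2 : ℝ) • x'⟫ = 0) : ⟪f x - f x', g y - g y'⟫ = 0 := by
  have h₁ := F.inner_eq_zero hx hy hy' h
  have h₂ := F.inner_eq_zero hx' hy hy' h'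
  rw [real_inner_comm, inner_sub_right]
  rw [inner_sub_right, real_inner_smul_right] at h₁ h₂
  linarith

lemma inner_centralDiff_pos (F : IsotonicFrame B f g u s) {c : E} (hc : ‖c‖ ≤ 6 * s) (i : ι) :
    0 < ⟪centralDiff f c (u i), centralDiff g c (u i)⟫ := by
  have hne : c + u i ≠ c - u i := by
    intro h
    refine F.basis_ne_zero i ?_
    have h2 : (2 : ℝ) • u i = (c + u i) - (c - u i) := by module
    rw [h, sub_self] at h2
    exact (smul_eq_zero.mp h2).resolve_left two_ne_zero
  have h₁ := F.inner_neg (F.add_basis_mem hc i) (F.sub_basis_mem hc i) hne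
  have h₂ := F.inner_neg (F.sub_basis_mem hc i) (F.add_basis_mem hc i) hne.symm
  rw [← neg_sub (g (c + u i)), inner_neg_left, add_comm (g (c - u i))] at h₂
  rw [inner_sub_right, real_inner_smul_right] at h₁ h₂
  rw [centralDiff, centralDiff, real_inner_comm, inner_sub_right]
  linarith

/-- `g y - g y'` is orthogonal to `f`-differences in directions `u j` when `y` and `y'` are
reflections of each other in the hyperplane through `c` orthogonal to `u i`, with `i ≠ j`. -/
lemma inner_centralDiff_sub (F : IsotonicFrame B f g u s) {c : E} (hc : ‖c‖ ≤ 6 * s) {i j : ι}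
    (hij : j ≠ i) {y y' : E} (hy : y ∈ B) (hy' : y' ∈ B) {r : ℝ} (hr : y - y' = r • u i)
    (hm : ⟪u i, y + y' - (2 : ℝ) • c⟫ = 0) : ⟪centralDiff f c (u j), g y - g y'⟫ = 0 := by
  refine F.inner_sub_eq_zero (F.add_basis_mem hc j) (F.sub_basis_mem hc j) hy hy' ?_ ?_
  · rw [hr, real_inner_smul_left, smul_add, ← sub_sub, inner_sub_right, hm,
      real_inner_smul_right, F.ortho i j hij.symm]
    simp
  · rw [hr, real_inner_smul_left, smul_sub, ← sub_add, inner_add_right, hm,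
      real_inner_smul_right, F.ortho i j hij.symm]
    simp

lemma inner_centralDiff_eq_zero (F : IsotonicFrame B f g u s) {c : E} (hc : ‖c‖ ≤ 6 * s) {j k : ι}
    (hjk : j ≠ k) : ⟪centralDiff f c (u j), centralDiff g c (u k)⟫ = 0 := by
  refine F.inner_centralDiff_sub hc hjk (F.add_basis_mem hc k) (F.sub_basis_mem hc k)
    (r := 2) (by module) ?_
  rw [show c + u k + (c - u k) - (2 : ℝ) • c = 0 by module, inner_zero_right]

lemma map_sub_ne_zero (F : IsotonicFrame B f g u s) (i : ι) {y y' : E} (hy : y ∈ B)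
    (hy' : y' ∈ B) {r : ℝ} (hr0 : r ≠ 0) (hr : y - y' = r • u i) : g y - g y' ≠ 0 := by
  intro h
  have hyy := F.inj hy hy' (sub_eq_zero.mp h)
  rw [hyy, sub_self] at hr
  exact smul_ne_zero hr0 (F.basis_ne_zero i) hr.symm

lemma centralDiff_ne_zero (F : IsotonicFrame B f g u s) {c : E} (hc : ‖c‖ ≤ 6 * s) (i : ι) :
    centralDiff g c (u i) ≠ 0 :=
  F.map_sub_ne_zero i (F.add_basis_mem hc i) (F.sub_basis_mem hc i) two_ne_zero (by module)

variable [FiniteDimensional ℝ E]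

/-- `g` maps pairs of mirror points to pairs in a fixed direction. -/
lemma exists_sub_eq_smul (F : IsotonicFrame B f g u s) {c : E} (hc : ‖c‖ ≤ 6 * s) (i : ι)
    {y y' : E} (hy : y ∈ B) (hy' : y' ∈ B) {r : ℝ} (hr : y - y' = r • u i)
    (hm : ⟪u i, y + y' - (2 : ℝ) • c⟫ = 0) : ∃ a : ℝ, g y - g y' = a • centralDiff g c (u i) :=
  exists_eq_smul_of_biorthogonal_s14 F.card_eq (m := fun j => centralDiff f c (u j))
    (n := fun j => centralDiff g c (u j))
    (fun _ _ hjk => F.inner_centralDiff_eq_zero hc hjk)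
    (fun j => (F.inner_centralDiff_pos hc j).ne') i
    (fun _ hj => F.inner_centralDiff_sub hc hj hy hy' hr hm)

/-- The image directions at a common centre are mutually orthogonal. -/
lemma inner_centralDiff_right_eq_zero (F : IsotonicFrame B f g u s) {c : E} (hc : ‖c‖ ≤ 6 * s)
    {i j : ι} (hij : i ≠ j) : ⟪centralDiff g c (u i), centralDiff g c (u j)⟫ = 0 := by
  have hui := F.norm_eq i
  have huj := F.norm_eq j
  have oij := F.ortho i j hij
  have oji := F.ortho j i hij.symm
  have hA : c + (u i + u j) ∈ B := F.add_mem hc ((norm_add_le _ _).trans (by linarith))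
  have hB : c + (-u i + u j) ∈ B :=
    F.add_mem hc ((norm_add_le _ _).trans (by rw [norm_neg]; linarith))
  have hC : c + (u i - u j) ∈ B := F.add_mem hc ((norm_sub_le _ _).trans (by linarith))
  have hD : c + (-u i - u j) ∈ B :=
    F.add_mem hc ((norm_sub_le _ _).trans (by rw [norm_neg]; linarith))
  have rAB : c + (u i + u j) - (c + (-u i + u j)) = (2 : ℝ) • u i := by module
  have rCD : c + (u i - u j) - (c + (-u i - u j)) = (2 : ℝ) • u i := by module
  have rAC : c + (u i + u j) - (c + (u i - u j)) = (2 : ℝ) • u j := by module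
  have rBD : c + (-u i + u j) - (c + (-u i - u j)) = (2 : ℝ) • u j := by module
  have mAB : ⟪u i, c + (u i + u j) + (c + (-u i + u j)) - (2 : ℝ) • c⟫ = 0 := by
    rw [show c + (u i + u j) + (c + (-u i + u j)) - (2 : ℝ) • c = (2 : ℝ) • u j by module,
      real_inner_smul_right, oij, mul_zero]
  have mCD : ⟪u i, c + (u i - u j) + (c + (-u i - u j)) - (2 : ℝ) • c⟫ = 0 := by
    rw [show c + (u i - u j) + (c + (-u i - u j)) - (2 : ℝ) • c = (-2 : ℝ) • u j by module,
      real_inner_smul_right, oij, mul_zero]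
  have mAC : ⟪u j, c + (u i + u j) + (c + (u i - u j)) - (2 : ℝ) • c⟫ = 0 := by
    rw [show c + (u i + u j) + (c + (u i - u j)) - (2 : ℝ) • c = (2 : ℝ) • u i by module,
      real_inner_smul_right, oji, mul_zero]
  have mBD : ⟪u j, c + (-u i + u j) + (c + (-u i - u j)) - (2 : ℝ) • c⟫ = 0 := by
    rw [show c + (-u i + u j) + (c + (-u i - u j)) - (2 : ℝ) • c = (-2 : ℝ) • u i by module,
      real_inner_smul_right, oji, mul_zero]
  have hcB : c ∈ B := F.mem c (by linarith [F.pos])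
  obtain ⟨α, hα⟩ := F.exists_sub_eq_smul hc i hA hB rAB mAB
  obtain ⟨β, hβ⟩ := F.exists_sub_eq_smul hc i hC hD rCD mCD
  obtain ⟨γ, hγ⟩ := F.exists_sub_eq_smul hc j hA hC rAC mAC
  obtain ⟨δ, hδ⟩ := F.exists_sub_eq_smul hc j hB hD rBD mBD
  have eAB := F.inner_eq_zero hcB hA hB (by rw [rAB, real_inner_smul_left, mAB, mul_zero])
  have eCD := F.inner_eq_zero hcB hC hD (by rw [rCD, real_inner_smul_left, mCD, mul_zero])
  have nAB := F.map_sub_ne_zero i hA hB two_ne_zero rAB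
  have nAC := F.map_sub_ne_zero j hA hC two_ne_zero rAC
  have hij' := F.inner_centralDiff_eq_zero hc hij
  have hji' := F.inner_centralDiff_eq_zero hc hij.symm
  have pi := F.inner_centralDiff_pos hc i
  have pj := F.inner_centralDiff_pos hc j
  set A := g (c + (u i + u j))
  set B' := g (c + (-u i + u j))
  set C := g (c + (u i - u j))
  set D := g (c + (-u i - u j))
  set n := centralDiff g c (u i)
  set n' := centralDiff g c (u j)
  have hpar : (α - β) • n = (γ - δ) • n' := by
    rw [sub_smul, sub_smul, ← hα, ← hβ, ← hγ, ← hδ]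
    abel
  have hαβ : α = β := by
    have h := congrArg (fun v => ⟪centralDiff f c (u i), v⟫) hpar
    simp only [real_inner_smul_right, hij', mul_zero] at h
    exact sub_eq_zero.mp ((mul_eq_zero.mp h).resolve_right pi.ne')
  have hγδ : γ = δ := by
    have h := congrArg (fun v => ⟪centralDiff f c (u j), v⟫) hpar
    simp only [real_inner_smul_right, hji', mul_zero] at h
    exact sub_eq_zero.mp ((mul_eq_zero.mp h.symm).resolve_right pj.ne')
  rw [hβ, ← hαβ] at eCD
  rw [hα] at eAB
  have hsum : ⟪α • n, (A - C) + (B' - D)⟫ = 0 := by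
    rw [show (A - C) + (B' - D) = (A + B' - (2 : ℝ) • f c) - (C + D - (2 : ℝ) • f c) by abel,
      inner_sub_right, eAB, eCD, sub_zero]
  rw [hγ, hδ, ← hγδ, ← add_smul, real_inner_smul_left, real_inner_smul_right] at hsum
  have hα0 : α ≠ 0 := by
    rintro rfl
    exact nAB (by rw [hα, zero_smul])
  have hγ0 : γ ≠ 0 := by
    rintro rfl
    exact nAC (by rw [hγ, zero_smul])
  have h := (mul_eq_zero.mp hsum).resolve_left hα0
  refine (mul_eq_zero.mp h).resolve_left ?_
  rw [← two_mul]
  exact mul_ne_zero two_ne_zero hγ0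

/-- The image direction of `u i` is the same at all centres on the axis spanned by `u i`. -/
lemma exists_centralDiff_smul_eq (F : IsotonicFrame B f g u s) (i : ι) {t : ℝ} (ht : |t| ≤ 3) :
    ∃ a : ℝ, centralDiff g (t • u i) (u i) = a • centralDiff g 0 (u i) := by
  have hs := F.pos
  have h0 : ‖(0 : E)‖ ≤ 6 * s := by rw [norm_zero]; linarith
  have hc : ‖t • u i‖ ≤ 6 * s := by
    rw [norm_smul, F.norm_eq, Real.norm_eq_abs]
    nlinarith
  refine exists_eq_smul_of_biorthogonal_s14 F.card_eq (m := fun j => centralDiff g 0 (u j))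
    (n := fun j => centralDiff g 0 (u j))
    (fun j k hjk => F.inner_centralDiff_right_eq_zero h0 hjk)
    (fun j => (real_inner_self_eq_norm_sq _).trans_ne
      (pow_ne_zero 2 (norm_ne_zero_iff.mpr (F.centralDiff_ne_zero h0 j)))) i fun j hj => ?_
  obtain ⟨a, ha⟩ := F.exists_sub_eq_smul hc j (F.add_basis_mem h0 j) (F.sub_basis_mem h0 j)
    (r := 2) (by module) (by
      rw [show 0 + u j + (0 - u j) - (2 : ℝ) • t • u i = (-2 * t) • u i by module,
        real_inner_smul_right, F.ortho j i hj, mul_zero])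
  change centralDiff g 0 (u j) = _ at ha
  rw [ha, real_inner_smul_left, F.inner_centralDiff_right_eq_zero hc hj, mul_zero]

/-- Along an axis, `f` at a midpoint is the mean of the values of `g` at the endpoints, in the
image direction of that axis. -/
lemma inner_map_add_map (F : IsotonicFrame B f g u s) (i : ι) {a b : ℝ} (ha : |a| ≤ 3)
    (hb : |b| ≤ 3) (hab : a ≠ b) :
    ⟪centralDiff g 0 (u i), g (a • u i) + g (b • u i)⟫ =
      2 * ⟪centralDiff g 0 (u i), f (((a + b) / 2) • u i)⟫ := by
  have ht : |(a + b) / 2| ≤ 3 := by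
    rw [abs_le] at *
    constructor <;> linarith
  have hs := F.pos
  have hc : ‖((a + b) / 2) • u i‖ ≤ 6 * s := by
    rw [norm_smul, F.norm_eq, Real.norm_eq_abs]
    nlinarith
  have hr : a • u i - b • u i = (a - b) • u i := by module
  have hm : a • u i + b • u i - (2 : ℝ) • ((a + b) / 2) • u i = 0 := by module
  obtain ⟨q, hq⟩ := F.exists_sub_eq_smul hc i (F.smul_mem i ha) (F.smul_mem i hb) hr
    (by rw [hm, inner_zero_right])
  obtain ⟨q', hq'⟩ := F.exists_centralDiff_smul_eq i ht
  have hne := F.map_sub_ne_zero i (F.smul_mem i ha) (F.smul_mem i hb) (sub_ne_zero.mpr hab) hr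
  have h := F.inner_eq_zero (F.smul_mem i ht) (F.smul_mem i ha) (F.smul_mem i hb)
    (by rw [hm, inner_zero_right])
  rw [hq, hq', smul_smul] at h hne
  rw [real_inner_smul_left] at h
  have h' := (mul_eq_zero.mp h).resolve_left fun h0 => hne (by rw [h0, zero_smul])
  rw [inner_sub_right, real_inner_smul_right] at h'
  linarith

/-- The two maps of an isotonic pair agree at the origin. -/
theorem map_zero_eq (F : IsotonicFrame B f g u s) : f 0 = g 0 := by
  have hs := F.pos
  have h0 : ‖(0 : E)‖ ≤ 6 * s := by rw [norm_zero]; linarith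
  rw [← sub_eq_zero]
  refine eq_zero_of_biorthogonal F.card_eq (m := fun j => centralDiff g 0 (u j))
    (n := fun j => centralDiff g 0 (u j))
    (fun j k hjk => F.inner_centralDiff_right_eq_zero h0 hjk)
    (fun j => (real_inner_self_eq_norm_sq _).trans_ne
      (pow_ne_zero 2 (norm_ne_zero_iff.mpr (F.centralDiff_ne_zero h0 j)))) fun i => ?_
  have key : ∀ a b : ℝ, |a| ≤ 3 → |b| ≤ 3 → a ≠ b → _ := fun a b ha hb hab =>
    F.inner_map_add_map i ha hb hab
  have h₁ := key (-1) 1 (by norm_num) (by norm_num) (by norm_num)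
  have h₂ := key 0 2 (by norm_num) (by norm_num) (by norm_num)
  have h₃ := key (-1) 3 (by norm_num) (by norm_num) (by norm_num)
  have h₄ := key 1 2 (by norm_num) (by norm_num) (by norm_num)
  have h₅ := key 0 3 (by norm_num) (by norm_num) (by norm_num)
  norm_num [inner_add_right] at h₁ h₂ h₃ h₄ h₅
  rw [inner_sub_right]
  linarith

end IsotonicFrame

/-- **Lemma: `f` and `g` agree at the center.** Let `p ≥ 2`, let
`B ⊆ ℝ^p` be a non-empty open ball containing `0`, and let `(f, g)` be an
isotonic unfolding pair on `(B, B)` with `g 0 = 0`. Then `f 0 = 0`. -/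
theorem internal_unfolding_f_zero
    (p : ℕ) (hp : 2 ≤ p) (B : Set (EuclideanSpace ℝ (Fin p)))
    (hB : ∃ (z : EuclideanSpace ℝ (Fin p)) (r : ℝ), 0 < r ∧ B = Metric.ball z r)
    (h0 : (0 : EuclideanSpace ℝ (Fin p)) ∈ B)
    (f g : EuclideanSpace ℝ (Fin p) → EuclideanSpace ℝ (Fin p))
    (hf_inj : Set.InjOn f B) (hg_inj : Set.InjOn g B)
    (hpair : ∀ x ∈ B, ∀ y ∈ B, ∀ y' ∈ B,
      (‖x - y‖ < ‖x - y'‖ ↔ ‖f x - g y‖ < ‖f x - g y'‖))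
    (hg0 : g 0 = 0) :
    f 0 = 0 := by
  obtain ⟨z, r, -, rfl⟩ := hB
  obtain ⟨ε, hε, hsub⟩ := Metric.isOpen_iff.mp Metric.isOpen_ball 0 h0
  have hε' : 0 < ε / 16 := by positivity
  have F : IsotonicFrame (Metric.ball z r) f g
      (fun i : Fin p => (ε / 16) • EuclideanSpace.single i (1 : ℝ)) (ε / 16) :=
    { pair := hpair
      inj := hg_inj
      pos := hε'
      norm_eq := fun i => by
        rw [norm_smul, PiLp.norm_single, Real.norm_of_nonneg hε'.le]
        simp
      ortho := fun i j hij => by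
        rw [real_inner_smul_left, real_inner_smul_right,
          EuclideanSpace.orthonormal_single.inner_eq_zero hij, mul_zero, mul_zero]
      card_eq := by simp
      mem := fun v hv => hsub (by rw [mem_ball_zero_iff]; linarith) }
  rw [F.map_zero_eq, hg0]
end
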